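/- arXiv:2111.15228 — 2 statements merged into one kernel-verified Lean document; each statement's English description precedes it below -/
import Mathlib

section
/- (Zeroth-order gradient identity, Flaxman-type.) Let E be a real inner product space of finite dimension d ≥ 1, let f : E → ℝ be continuous, and let r > 0. Define the smoothed function f_r(x) = E_{U ∼ uniform(B_r)}[f(x + U)], where uniform(B_r) is the uniform probability measure on the closed ball of radius r centered at the origin. Then f_r is differentiable and its gradient satisfies ∇f_r(x) = (d/r²)·E_{U ∼ uniform(S_r)}[f(x + U)·U], where uniform(S_r) is the uniform probability measure on the sphere of radius r centered at the origin. -/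
noncomputable section
open MeasureTheory Metric

variable {E : Type*} [NormedAddCommGroup E] [InnerProductSpace ℝ E]
  [FiniteDimensional ℝ E] [MeasurableSpace E] [BorelSpace E]

/-- The uniform probability measure on the closed ball of radius `r` centered at the origin. -/
def uniformBall (r : ℝ) : Measure E :=
  (volume (closedBall (0 : E) r))⁻¹ • volume.restrict (closedBall (0 : E) r)

/-- The uniform probability measure on the sphere of radius `r` centered at the origin,
realized as a measure on `E`: the normalized spherical measure on the unit sphere,
pushed forward by scaling by `r`. -/
def uniformSphere (r : ℝ) : Measure E :=
  Measure.map (fun y : sphere (0 : E) 1 => r • (y : E))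
    (((volume : Measure E).toSphere Set.univ)⁻¹ • (volume : Measure E).toSphere)

open Set Filter Topology Module

/-- Integration in polar coordinates: radial integral of the integrals over spheres. -/
lemma integral_eq_integral_Ioi_toSphere [Nontrivial E] {F : Type*} [NormedAddCommGroup F]
    [NormedSpace ℝ F] {g : E → F} (hg : Integrable g) :
    ∫ u, g u = ∫ s in Ioi (0 : ℝ), s ^ (finrank ℝ E - 1) •
      ∫ θ : sphere (0 : E) 1, g (s • (θ : E)) ∂(volume : Measure E).toSphere := by
  set e := homeomorphUnitSphereProd E
  have hmp := (volume : Measure E).measurePreserving_homeomorphUnitSphereProd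
  have hcomp : ∀ u : ({0}ᶜ : Set E), g ((e u).2.1 • ((e u).1 : E)) = g u := fun u ↦ by
    have hu : (u : E) ≠ 0 := u.2
    congr 1
    simp [e, smul_smul, hu]
  have hint : Integrable (fun p : sphere (0 : E) 1 × Ioi (0 : ℝ) ↦ g (p.2.1 • (p.1 : E)))
      ((volume : Measure E).toSphere.prod (.volumeIoiPow (finrank ℝ E - 1))) := by
    rw [← hmp.integrable_comp_emb e.measurableEmbedding]
    refine Integrable.congr ?_ (.of_forall fun u ↦ (hcomp u).symm)
    exact (integrableOn_iff_comap_subtypeVal (measurableSet_singleton _).compl).1 hg.integrableOn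
  calc ∫ u, g u = ∫ u : ({0}ᶜ : Set E), g u ∂(volume.comap Subtype.val) := by
        rw [integral_subtype_comap (measurableSet_singleton _).compl g, restrict_compl_singleton]
    _ = ∫ p : sphere (0 : E) 1 × Ioi (0 : ℝ), g (p.2.1 • (p.1 : E))
          ∂((volume : Measure E).toSphere.prod (.volumeIoiPow (finrank ℝ E - 1))) := by
        rw [← hmp.integral_comp e.measurableEmbedding]
        exact integral_congr_ae (.of_forall fun u ↦ (hcomp u).symm)
    _ = ∫ s : Ioi (0 : ℝ), ∫ θ : sphere (0 : E) 1, g (s.1 • (θ : E))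
          ∂(volume : Measure E).toSphere ∂(.volumeIoiPow (finrank ℝ E - 1)) :=
        integral_prod_symm _ hint
    _ = _ := by
        simp only [Measure.volumeIoiPow, ENNReal.ofReal]
        rw [integral_withDensity_eq_integral_smul
            (measurable_subtype_coe.pow_const _).real_toNNReal,
          integral_subtype_comap measurableSet_Ioi fun s ↦
            Real.toNNReal (s ^ (finrank ℝ E - 1)) •
              ∫ θ : sphere (0 : E) 1, g (s • (θ : E)) ∂(volume : Measure E).toSphere]
        refine setIntegral_congr_fun measurableSet_Ioi fun s hs ↦ ?_
        simp only [NNReal.smul_def, Real.coe_toNNReal _ (pow_nonneg (le_of_lt hs) _)]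

/-- The derivative of the convolution of a continuous function with a compactly supported radial
kernel falls on the kernel. -/
lemma hasGradientAt_integral_mul_radial {f : E → ℝ} (hf : Continuous f) {ψ : ℝ → ℝ}
    (hψ : ContDiff ℝ 1 ψ) (hsupp : HasCompactSupport fun u : E ↦ ψ (‖u‖ ^ 2)) (x : E) :
    HasGradientAt (fun y ↦ ∫ u, f (y + u) * ψ (‖u‖ ^ 2))
      (∫ u, (-(2 * deriv ψ (‖u‖ ^ 2)) * f (x + u)) • u) x := by
  set g : E → ℝ := fun u ↦ ψ (‖u‖ ^ 2) with hg
  have hgC : ContDiff ℝ 1 g := hψ.comp (contDiff_norm_sq ℝ)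
  have hg' (u : E) : fderiv ℝ g u = (2 * deriv ψ (‖u‖ ^ 2)) • innerSL ℝ u := by
    have h := ((hψ.differentiable one_ne_zero (‖u‖ ^ 2)).hasDerivAt).comp_hasFDerivAt u
      (hasStrictFDerivAt_norm_sq u).hasFDerivAt
    rw [show g = ψ ∘ fun u ↦ ‖u‖ ^ 2 from rfl, h.fderiv]
    ext v
    simp
    ring
  have key := hsupp.hasFDerivAt_convolution_right (ContinuousLinearMap.mul ℝ ℝ)
    (hf.locallyIntegrable (μ := volume)) hgC x
  rw [hasGradientAt_iff_hasFDerivAt]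
  have hconv : (fun y ↦ ∫ u, f (y + u) * ψ (‖u‖ ^ 2)) =
      convolution f g (ContinuousLinearMap.mul ℝ ℝ) volume := by
    ext y
    rw [convolution_def, ← integral_add_left_eq_self (fun t ↦ ContinuousLinearMap.mul ℝ ℝ _ _) y]
    simp [hg]
  rw [hconv]
  refine key.congr_fderiv ?_
  ext v
  rw [convolution_precompR_apply _ hf.locallyIntegrable (hsupp.fderiv ℝ)
    (hgC.continuous_fderiv one_ne_zero), convolution_def, ← integral_add_left_eq_self _ x]
  have hint : Integrable fun u : E ↦ (-(2 * deriv ψ (‖u‖ ^ 2)) * f (x + u)) • u := by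
    have hc := hψ.continuous_deriv le_rfl
    refine Continuous.integrable_of_hasCompactSupport (by fun_prop) ?_
    refine (hsupp.fderiv ℝ).mono fun u hu h0 ↦ hu ?_
    have h := DFunLike.congr_fun h0 u
    rw [hg'] at h
    rcases eq_or_ne u 0 with rfl | hu0
    · simp
    · have : deriv ψ (‖u‖ ^ 2) = 0 := by simpa [hu0] using h
      simp [this]
  rw [InnerProductSpace.toDual_apply_apply, real_inner_comm, ← integral_inner hint]
  refine integral_congr_ae (.of_forall fun u ↦ ?_)
  simp [hg', inner_smul_right, real_inner_comm]
  ring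

/-- The unnormalized first moment of `f` over the sphere of radius `s` centered at `x`. -/
def sphereMoment (f : E → ℝ) (x : E) (s : ℝ) : E :=
  s ^ (finrank ℝ E - 1) •
    ∫ θ : sphere (0 : E) 1, f (x + s • (θ : E)) • (θ : E) ∂(volume : Measure E).toSphere

lemma continuous_sphereMoment {f : E → ℝ} (hf : Continuous f) :
    Continuous fun p : E × ℝ ↦ sphereMoment f p.1 p.2 := by
  have h := continuous_parametric_integral_of_continuous (X := E × ℝ)
    (μ := (volume : Measure E).toSphere)
    (f := fun p (θ : sphere (0 : E) 1) ↦ f (p.1 + p.2 • (θ : E)) • (θ : E))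
    (by unfold Function.uncurry; fun_prop) isCompact_univ
  simp only [Measure.restrict_univ] at h
  unfold sphereMoment
  fun_prop

/-- A smooth function of `t` that vanishes for `r ^ 2 ≤ t` and equals `1` for `t ≤ r ^ 2 - 1 / n`
if `n` is positive. -/
def sqCutoff (r : ℝ) (n : ℕ) (t : ℝ) : ℝ :=
  Real.smoothTransition (n * (r ^ 2 - t))

lemma contDiff_sqCutoff (r : ℝ) (n : ℕ) : ContDiff ℝ 1 (sqCutoff r n) :=
  (Real.smoothTransition.contDiff (n := 1)).comp (by fun_prop)

lemma antitone_sqCutoff (r : ℝ) (n : ℕ) : Antitone (sqCutoff r n) := fun _ _ h ↦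
  Real.smoothTransition.monotone (by gcongr)

lemma sqCutoff_eq_zero {r : ℝ} (n : ℕ) {t : ℝ} (ht : r ^ 2 ≤ t) : sqCutoff r n t = 0 :=
  Real.smoothTransition.zero_of_nonpos
    (mul_nonpos_of_nonneg_of_nonpos n.cast_nonneg (by linarith))

lemma sqCutoff_eq_one {r : ℝ} {n : ℕ} {t : ℝ} (ht : 1 ≤ n * (r ^ 2 - t)) : sqCutoff r n t = 1 :=
  Real.smoothTransition.one_of_one_le ht

lemma deriv_sqCutoff_of_sq_lt {r : ℝ} (n : ℕ) {t : ℝ} (ht : r ^ 2 < t) :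
    deriv (sqCutoff r n) t = 0 := by
  have : sqCutoff r n =ᶠ[𝓝 t] fun _ ↦ 0 := by
    filter_upwards [lt_mem_nhds ht] with s hs using sqCutoff_eq_zero n hs.le
  simp [this.deriv_eq]

lemma deriv_sqCutoff_of_one_lt {r : ℝ} {n : ℕ} {t : ℝ} (ht : 1 < n * (r ^ 2 - t)) :
    deriv (sqCutoff r n) t = 0 := by
  have : sqCutoff r n =ᶠ[𝓝 t] fun _ ↦ 1 := by
    have hc : ContinuousAt (fun s : ℝ ↦ n * (r ^ 2 - s)) t := by fun_prop
    filter_upwards [hc.eventually (lt_mem_nhds ht)] with s hs using sqCutoff_eq_one hs.le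
  simp [this.deriv_eq]

lemma hasCompactSupport_sqCutoff {F : Type*} [NormedAddCommGroup F] [ProperSpace F] {r : ℝ}
    (hr : 0 < r) (n : ℕ) : HasCompactSupport fun u : F ↦ sqCutoff r n (‖u‖ ^ 2) := by
  refine .intro (isCompact_closedBall (0 : F) r) fun u hu ↦ sqCutoff_eq_zero n ?_
  have : r < ‖u‖ := by simpa using hu
  gcongr

/-- Minus the derivative of `s ↦ sqCutoff r n (s ^ 2)`. -/
def radialDensity (r : ℝ) (n : ℕ) (s : ℝ) : ℝ := -(2 * deriv (sqCutoff r n) (s ^ 2)) * s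

lemma continuous_radialDensity (r : ℝ) (n : ℕ) : Continuous (radialDensity r n) := by
  have := (contDiff_sqCutoff r n).continuous_deriv le_rfl
  unfold radialDensity
  fun_prop

lemma radialDensity_nonneg (r : ℝ) (n : ℕ) {s : ℝ} (hs : 0 ≤ s) : 0 ≤ radialDensity r n s := by
  have := (antitone_sqCutoff r n).deriv_nonpos (x := s ^ 2)
  exact mul_nonneg (by linarith) hs

lemma hasCompactSupport_radialDensity {r : ℝ} (hr : 0 < r) (n : ℕ) :
    HasCompactSupport (radialDensity r n) := by
  refine .intro (isCompact_Icc (a := -r) (b := r)) fun s hs ↦ ?_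
  rw [radialDensity, deriv_sqCutoff_of_sq_lt n, mul_zero, neg_zero, zero_mul]
  rw [mem_Icc, ← abs_le, not_le] at hs
  rw [← sq_abs s]
  gcongr

lemma abs_sub_le_of_radialDensity_ne_zero {r : ℝ} (hr : 0 < r) {n : ℕ} (hn : 0 < n) {s : ℝ}
    (hs : 0 < s) (h : radialDensity r n s ≠ 0) : |s - r| ≤ 1 / (n * r) := by
  have hsr : s ≤ r := by
    by_contra! hsr
    have hsq : r ^ 2 < s ^ 2 := by gcongr
    exact h (by simp [radialDensity, deriv_sqCutoff_of_sq_lt n hsq])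
  have hns : n * (r ^ 2 - s ^ 2) ≤ 1 := by
    by_contra! hns
    exact h (by simp [radialDensity, deriv_sqCutoff_of_one_lt hns])
  have hn' : (0 : ℝ) < n := by exact_mod_cast hn
  rw [abs_sub_comm, abs_of_nonneg (by linarith), le_div_iff₀ (by positivity)]
  nlinarith [mul_nonneg hn'.le (mul_nonneg (sub_nonneg.2 hsr) hs.le)]

lemma integral_radialDensity {r : ℝ} {n : ℕ} (hr : 0 < r) (hn : 1 ≤ n * r ^ 2) :
    ∫ s in Ioi (0 : ℝ), radialDensity r n s = 1 := by
  have hderiv : ∀ s ∈ Ici (0 : ℝ),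
      HasDerivAt (fun s ↦ -sqCutoff r n (s ^ 2)) (radialDensity r n s) s := fun s _ ↦ by
    have h := ((contDiff_sqCutoff r n).differentiable one_ne_zero (s ^ 2)).hasDerivAt.comp s
      (hasDerivAt_pow 2 s)
    refine h.neg.congr_deriv ?_
    rw [radialDensity]
    push_cast
    ring
  have hlim : Tendsto (fun s ↦ -sqCutoff r n (s ^ 2)) atTop (𝓝 0) := by
    refine tendsto_const_nhds.congr' ?_
    filter_upwards [eventually_ge_atTop r] with s hs
    rw [sqCutoff_eq_zero n (by gcongr), neg_zero]
  rw [integral_Ioi_of_hasDerivAt_of_nonneg' hderiv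
    (fun s hs ↦ radialDensity_nonneg r n (le_of_lt hs)) hlim]
  simp [sqCutoff_eq_one (r := r) (n := n) (t := 0) (by simpa using hn)]

lemma integral_radial_eq_integral_sphereMoment [Nontrivial E] {f : E → ℝ} (hf : Continuous f)
    {r : ℝ} (hr : 0 < r) (n : ℕ) (x : E) :
    ∫ u, (-(2 * deriv (sqCutoff r n) (‖u‖ ^ 2)) * f (x + u)) • u =
      ∫ s in Ioi (0 : ℝ), radialDensity r n s • sphereMoment f x s := by
  have hint : Integrable fun u : E ↦ (-(2 * deriv (sqCutoff r n) (‖u‖ ^ 2)) * f (x + u)) • u := by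
    have hc := (contDiff_sqCutoff r n).continuous_deriv le_rfl
    refine Continuous.integrable_of_hasCompactSupport (by fun_prop) ?_
    refine .intro (isCompact_closedBall (0 : E) r) fun u hu ↦ ?_
    have : r < ‖u‖ := by simpa using hu
    rw [deriv_sqCutoff_of_sq_lt n (by gcongr)]
    simp
  rw [integral_eq_integral_Ioi_toSphere hint]
  refine setIntegral_congr_fun measurableSet_Ioi fun s hs ↦ ?_
  simp only [sphereMoment]
  rw [smul_comm (radialDensity r n s), ← integral_smul (radialDensity r n s)]
  congr 1
  refine integral_congr_ae (.of_forall fun θ ↦ ?_)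
  simp only [norm_smul, norm_eq_of_mem_sphere, mul_one, Real.norm_eq_abs, sq_abs, radialDensity,
    smul_smul]
  ring_nf

lemma norm_integral_radialDensity_smul_sub_le {F : Type*} [NormedAddCommGroup F]
    [NormedSpace ℝ F] [CompleteSpace F] {r : ℝ} (hr : 0 < r) {n : ℕ} (hn : 0 < n)
    (hnr : 1 ≤ n * r ^ 2) {A : ℝ → F} (hA : Continuous A) {ε : ℝ}
    (hAε : ∀ s, |s - r| ≤ 1 / (n * r) → ‖A s - A r‖ ≤ ε) :
    ‖(∫ s in Ioi (0 : ℝ), radialDensity r n s • A s) - A r‖ ≤ ε := by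
  have hρ := continuous_radialDensity r n
  have hsupp := hasCompactSupport_radialDensity hr n
  have hint : Integrable (radialDensity r n) := hρ.integrable_of_hasCompactSupport hsupp
  have hintA : Integrable fun s ↦ radialDensity r n s • A s :=
    (hρ.smul hA).integrable_of_hasCompactSupport hsupp.smul_right
  calc ‖(∫ s in Ioi (0 : ℝ), radialDensity r n s • A s) - A r‖
      = ‖∫ s in Ioi (0 : ℝ), radialDensity r n s • (A s - A r)‖ := by
        simp only [smul_sub]
        rw [integral_sub hintA.integrableOn (hint.smul_const _).integrableOn,
          integral_smul_const, integral_radialDensity hr hnr, one_smul]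
    _ ≤ ∫ s in Ioi (0 : ℝ), radialDensity r n s * ε := by
        refine norm_integral_le_of_norm_le (hint.mul_const _).integrableOn ?_
        filter_upwards [ae_restrict_mem measurableSet_Ioi] with s hs
        rw [norm_smul, Real.norm_of_nonneg (radialDensity_nonneg r n (le_of_lt hs))]
        by_cases h : radialDensity r n s = 0
        · simp [h]
        · gcongr
          · exact radialDensity_nonneg r n (le_of_lt hs)
          · exact hAε s (abs_sub_le_of_radialDensity_ne_zero hr hn hs h)
    _ = ε := by rw [integral_mul_const, integral_radialDensity hr hnr, one_mul]

lemma tendstoUniformlyOnFilter_integral_sphereMoment {f : E → ℝ} (hf : Continuous f) {r : ℝ}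
    (hr : 0 < r) (x : E) :
    TendstoUniformlyOnFilter
      (fun (n : ℕ) y ↦ ∫ s in Ioi (0 : ℝ), radialDensity r n s • sphereMoment f y s)
      (fun y ↦ sphereMoment f y r) atTop (𝓝 x) := by
  rw [Metric.tendstoUniformlyOnFilter_iff]
  intro ε hε
  have hc := continuous_sphereMoment hf
  obtain ⟨δ, hδ, hclose⟩ := Metric.continuousAt_iff.1 (hc.continuousAt (x := (x, r))) (ε / 4)
    (by positivity)
  have hlim : Tendsto (fun n : ℕ ↦ 1 / ((n : ℝ) * r)) atTop (𝓝 0) :=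
    tendsto_const_nhds.div_atTop (tendsto_natCast_atTop_atTop.atTop_mul_const hr)
  have hlarge : ∀ᶠ n : ℕ in atTop, 1 ≤ (n : ℝ) * r ^ 2 :=
    (tendsto_natCast_atTop_atTop.atTop_mul_const (by positivity)).eventually_ge_atTop 1
  have hn := (hlim.eventually (gt_mem_nhds hδ)).and (hlarge.and (eventually_gt_atTop 0))
  filter_upwards [hn.prod_mk (Metric.ball_mem_nhds x hδ)] with ⟨n, y⟩ ⟨⟨hnδ, hnr, hn0⟩, hy⟩
  rw [dist_comm, dist_eq_norm]
  refine (norm_integral_radialDensity_smul_sub_le hr hn0 hnr (ε := ε / 2)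
    (hc.comp (by fun_prop : Continuous fun s : ℝ ↦ (y, s))) fun s hs ↦ ?_).trans_lt (by linarith)
  have hys : dist (y, s) (x, r) < δ := by
    rw [Prod.dist_eq, max_lt_iff]
    exact ⟨hy, hs.trans_lt hnδ⟩
  have hyr : dist (y, r) (x, r) < δ := by
    rw [Prod.dist_eq, max_lt_iff]
    exact ⟨hy, by simpa using hδ⟩
  rw [← dist_eq_norm]
  refine (dist_triangle_right _ _ (sphereMoment f x r)).trans ?_
  have h₁ := hclose hys
  have h₂ := hclose hyr
  dsimp only [Function.comp_apply] at h₁ h₂ ⊢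
  linarith

lemma tendsto_integral_mul_sqCutoff [Nontrivial E] {f : E → ℝ} (hf : Continuous f) {r : ℝ}
    (hr : 0 < r) (y : E) :
    Tendsto (fun n : ℕ ↦ ∫ u, f (y + u) * sqCutoff r n (‖u‖ ^ 2)) atTop
      (𝓝 (∫ u in closedBall (0 : E) r, f (y + u))) := by
  have hfy : Continuous fun u ↦ f (y + u) := by fun_prop
  have hball : ∫ u in closedBall (0 : E) r, f (y + u) =
      ∫ u, (ball (0 : E) r).indicator (fun u ↦ f (y + u)) u := by
    rw [integral_indicator measurableSet_ball]
    exact setIntegral_congr_set (ae_eq_of_subset_of_measure_ge ball_subset_closedBall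
      (Measure.addHaar_closedBall_eq_addHaar_ball _ _ _).le
      measurableSet_ball.nullMeasurableSet measure_closedBall_lt_top.ne).symm
  rw [hball]
  refine tendsto_integral_of_dominated_convergence
    ((closedBall (0 : E) r).indicator fun u ↦ ‖f (y + u)‖) (fun n ↦ ?_) ?_ (fun n ↦ ?_) ?_
  · have := (contDiff_sqCutoff r n).continuous
    exact Continuous.aestronglyMeasurable (by fun_prop)
  · rw [integrable_indicator_iff measurableSet_closedBall]
    exact hfy.norm.continuousOn.integrableOn_compact (isCompact_closedBall _ _)
  · refine .of_forall fun u ↦ ?_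
    by_cases hu : u ∈ closedBall (0 : E) r
    · rw [indicator_of_mem hu, norm_mul]
      refine mul_le_of_le_one_right (norm_nonneg _) ?_
      rw [sqCutoff, Real.norm_of_nonneg (Real.smoothTransition.nonneg _)]
      exact Real.smoothTransition.le_one _
    · have : r < ‖u‖ := by simpa using hu
      rw [indicator_of_notMem hu, sqCutoff_eq_zero n (by gcongr)]
      simp
  · refine .of_forall fun u ↦ tendsto_const_nhds.congr' ?_
    by_cases hu : u ∈ ball (0 : E) r
    · have hu' : 0 < r ^ 2 - ‖u‖ ^ 2 := by
        have : ‖u‖ < r := by simpa using hu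
        rw [sub_pos]
        gcongr
      filter_upwards [(tendsto_natCast_atTop_atTop.atTop_mul_const hu').eventually_ge_atTop 1]
        with n hn
      rw [indicator_of_mem hu, sqCutoff_eq_one hn, mul_one]
    · have : r ≤ ‖u‖ := by simpa using hu
      refine .of_forall fun n ↦ ?_
      simp only [indicator_of_notMem hu]
      rw [sqCutoff_eq_zero n (by gcongr), mul_zero]

/-- The gradient of the integral over a moving ball is the first moment over its boundary. -/
lemma hasGradientAt_setIntegral_closedBall [Nontrivial E] {f : E → ℝ} (hf : Continuous f) {r : ℝ}
    (hr : 0 < r) (x : E) :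
    HasGradientAt (fun y ↦ ∫ u in closedBall (0 : E) r, f (y + u)) (sphereMoment f x r) x := by
  rw [hasGradientAt_iff_hasFDerivAt]
  refine hasFDerivAt_of_tendstoUniformlyOnFilter (l := atTop)
    (g' := fun y ↦ InnerProductSpace.toDual ℝ E (sphereMoment f y r))
    ((InnerProductSpace.toDual ℝ E).isometry.uniformContinuous.comp_tendstoUniformlyOnFilter
      (tendstoUniformlyOnFilter_integral_sphereMoment hf hr x))
    (.of_forall fun p ↦ ?_) (.of_forall fun y ↦ tendsto_integral_mul_sqCutoff hf hr y)
  have h := hasGradientAt_integral_mul_radial hf (contDiff_sqCutoff r p.1)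
    (hasCompactSupport_sqCutoff hr p.1) p.2
  rw [integral_radial_eq_integral_sphereMoment hf hr] at h
  exact h.hasFDerivAt

lemma integral_uniformBall (r : ℝ) (g : E → ℝ) :
    ∫ u, g u ∂(uniformBall (E := E) r) =
      (volume.real (closedBall (0 : E) r))⁻¹ * ∫ u in closedBall (0 : E) r, g u := by
  simp [uniformBall, integral_smul_measure, measureReal_def]

lemma integral_uniformSphere {r : ℝ} {F : Type*} [NormedAddCommGroup F] [NormedSpace ℝ F]
    {g : E → F} (hg : Continuous g) :
    ∫ u, g u ∂(uniformSphere (E := E) r) = ((volume : Measure E).toSphere.real univ)⁻¹ •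
      ∫ θ : sphere (0 : E) 1, g (r • (θ : E)) ∂(volume : Measure E).toSphere := by
  rw [uniformSphere, integral_map (by fun_prop) hg.aestronglyMeasurable,
    integral_smul_measure, measureReal_def, ENNReal.toReal_inv]

/-- zeroth-order (Flaxman-type) gradient identity. The ball-smoothed
function `f_r(x) = E_{U ∼ uniform(B_r)}[f(x+U)]` is differentiable with gradient
`∇f_r(x) = (d/r²)·E_{U ∼ uniform(S_r)}[f(x+U)·U]`. -/
theorem gradient_of_ball_smoothing (hdim : 1 ≤ Module.finrank ℝ E)
    (f : E → ℝ) (hf : Continuous f) (r : ℝ) (hr : 0 < r) :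
    ∀ x : E, HasGradientAt (fun y => ∫ u, f (y + u) ∂(uniformBall (E := E) r))
      (((Module.finrank ℝ E : ℝ) / r ^ 2) • ∫ u, f (x + u) • u ∂(uniformSphere (E := E) r))
      x := by
  intro x
  have : Nontrivial E := Module.nontrivial_of_finrank_pos hdim
  simp only [integral_uniformBall]
  have h := (hasGradientAt_setIntegral_closedBall hf hr x).hasFDerivAt.const_mul
    (volume.real (closedBall (0 : E) r))⁻¹
  rw [hasGradientAt_iff_hasFDerivAt]
  refine h.congr_fderiv ?_
  rw [← map_smul]
  congr 1
  have hω : volume.real (ball (0 : E) 1) ≠ 0 :=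
    (ENNReal.toReal_pos (isOpen_ball.measure_ne_zero _ (by simp)) measure_ball_lt_top.ne).ne'
  have hd : (finrank ℝ E : ℝ) ≠ 0 := by positivity
  obtain ⟨k, hk⟩ : ∃ k, finrank ℝ E = k + 1 := ⟨_, (Nat.sub_add_cancel hdim).symm⟩
  rw [integral_uniformSphere (by fun_prop), Measure.toSphere_real_apply_univ, sphereMoment,
    Measure.addHaar_real_closedBall _ _ hr.le]
  simp only [smul_comm _ r]
  rw [integral_smul]
  simp only [smul_smul]
  congr 1
  rw [hk] at hd ⊢
  simp only [Nat.add_sub_cancel]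
  field_simp
  ring
end
end

section
/- (Smoothing bias bound.) Let E be a real inner product space of finite dimension d ≥ 1, let f : E → ℝ be continuously differentiable, let r > 0 and δ ≥ 0, and fix x ∈ E. If ‖∇f(x + u) − ∇f(x)‖ ≤ δ for every u with ‖u‖ ≤ r, then the smoothed function f_r(x) = E_{U ∼ uniform(B_r)}[f(x + U)] satisfies ‖∇f_r(x) − ∇f(x)‖ ≤ δ. -/
noncomputable section
open MeasureTheory Metric

variable {E : Type*} [NormedAddCommGroup E] [InnerProductSpace ℝ E]
  [FiniteDimensional ℝ E] [MeasurableSpace E] [BorelSpace E]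

theorem isProbabilityMeasure_uniformBall {r : ℝ} (hr : 0 < r) :
    IsProbabilityMeasure (uniformBall (E := E) r) where
  measure_univ := by
    simp only [uniformBall, Measure.smul_apply, Measure.restrict_apply_univ, smul_eq_mul]
    exact ENNReal.inv_mul_cancel (measure_closedBall_pos volume 0 hr).ne'
      measure_closedBall_lt_top.ne

theorem ae_uniformBall_norm_le (r : ℝ) : ∀ᵐ u ∂(uniformBall (E := E) r), ‖u‖ ≤ r := by
  refine Measure.ae_smul_measure ?_ _
  filter_upwards [ae_restrict_mem measurableSet_closedBall] with u hu
  simpa using hu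

theorem Continuous.integrable_uniformBall {F : Type*} [NormedAddCommGroup F] {g : E → F}
    (hg : Continuous g) {r : ℝ} (hr : 0 < r) : Integrable g (uniformBall (E := E) r) :=
  (hg.continuousOn.integrableOn_compact (isCompact_closedBall 0 r)).smul_measure
    (ENNReal.inv_ne_top.2 (measure_closedBall_pos volume 0 hr).ne')

/-- Differentiation under the integral sign for ball smoothing. -/
theorem hasFDerivAt_integral_uniformBall {f : E → ℝ} (hf : ContDiff ℝ 1 f) {r : ℝ} (hr : 0 < r)
    (x : E) :
    HasFDerivAt (fun y => ∫ u, f (y + u) ∂(uniformBall (E := E) r))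
      (∫ u, fderiv ℝ f (x + u) ∂(uniformBall (E := E) r)) x := by
  have := isProbabilityMeasure_uniformBall (E := E) hr
  have hf' : Continuous (fderiv ℝ f) := hf.continuous_fderiv one_ne_zero
  obtain ⟨C, hC⟩ := (isCompact_closedBall x (1 + r)).exists_bound_of_continuousOn
    hf'.continuousOn
  refine hasFDerivAt_integral_of_dominated_of_fderiv_le (𝕜 := ℝ) (bound := fun _ => C)
    (F := fun y u => f (y + u)) (F' := fun y u => fderiv ℝ f (y + u))
    (ball_mem_nhds x one_pos) (.of_forall fun y => ?_) ?_ ?_ ?_ (integrable_const C) ?_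
  · exact (hf.continuous.comp (continuous_const_add y)).aestronglyMeasurable
  · exact (hf.continuous.comp (continuous_const_add x)).integrable_uniformBall hr
  · exact (hf'.comp (continuous_const_add x)).aestronglyMeasurable
  · filter_upwards [ae_uniformBall_norm_le r] with u hu y hy
    refine hC _ (mem_closedBall_iff_norm.2 ?_)
    rw [add_sub_right_comm]
    exact (norm_add_le _ _).trans (add_le_add (mem_ball_iff_norm.1 hy).le hu)
  · exact .of_forall fun u y _ =>
      (hasFDerivAt_comp_add_right u).2 (hf.differentiable one_ne_zero (y + u)).hasFDerivAt

theorem norm_gradient_sub_gradient {V : Type*} [NormedAddCommGroup V] [InnerProductSpace ℝ V]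
    [CompleteSpace V] (f g : V → ℝ) (x y : V) :
    ‖gradient f x - gradient g y‖ = ‖fderiv ℝ f x - fderiv ℝ g y‖ := by
  rw [gradient, gradient, ← map_sub, LinearIsometryEquiv.norm_map]

/-- smoothing bias bound. If the gradient of a C¹ function `f` varies by at
most `δ` over the ball of radius `r` around `x`, then the gradient of the ball-smoothed
function `f_r(x) = E_{U ∼ uniform(B_r)}[f(x+U)]` is `δ`-close to `∇f(x)`. -/
theorem smoothing_bias_bound (hdim : 1 ≤ Module.finrank ℝ E)
    (f : E → ℝ) (hf : ContDiff ℝ 1 f) (r δ : ℝ) (hr : 0 < r) (hδ : 0 ≤ δ) (x : E)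
    (hvar : ∀ u : E, ‖u‖ ≤ r → ‖gradient f (x + u) - gradient f x‖ ≤ δ) :
    ‖gradient (fun y => ∫ u, f (y + u) ∂(uniformBall (E := E) r)) x - gradient f x‖ ≤ δ := by
  have := isProbabilityMeasure_uniformBall (E := E) hr
  have hint : Integrable (fun u => fderiv ℝ f (x + u)) (uniformBall (E := E) r) :=
    ((hf.continuous_fderiv one_ne_zero).comp (continuous_const_add x)).integrable_uniformBall hr
  rw [norm_gradient_sub_gradient, (hasFDerivAt_integral_uniformBall hf hr x).fderiv]
  calc ‖∫ u, fderiv ℝ f (x + u) ∂(uniformBall (E := E) r) - fderiv ℝ f x‖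
      = ‖∫ u, (fderiv ℝ f (x + u) - fderiv ℝ f x) ∂(uniformBall (E := E) r)‖ := by
        rw [integral_sub hint (integrable_const _), integral_const, probReal_univ, one_smul]
    _ ≤ δ * (uniformBall (E := E) r).real Set.univ := by
        refine norm_integral_le_of_norm_le_const ?_
        filter_upwards [ae_uniformBall_norm_le r] with u hu
        rw [← norm_gradient_sub_gradient]
        exact hvar u hu
    _ = δ := by rw [probReal_univ, mul_one]
end
end
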